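/- Let G be an (n,W)-mean payoff game (a mean payoff game whose underlying graph is an (n,W)-graph) and A an (n,W)-separating automaton. Then Eve has a strategy ensuring mean payoff in G if and only if she has a strategy ensuring safety in the safety game G × A. -/

import Mathlib

open Filter


/-- A finite path: a list of consecutive edges, all belonging to `E`,
starting at `u` (when nonempty). -/
def FinPath {V : Type} (E : Set (V × ℤ × V)) (u : V) (p : List (V × ℤ × V)) : Prop :=
  (∀ e ∈ p, e ∈ E) ∧ List.Chain' (fun e e' => e.2.2 = e'.1) p ∧
    ∀ h : p ≠ [], (p.head h).1 = u

/-- The last vertex of a finite path starting at `u` (which is `u` itself for the empty path). -/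
def lastV {V : Type} (u : V) (p : List (V × ℤ × V)) : V :=
  (p.getLastD (u, 0, u)).2.2

/-- An infinite path: a sequence of consecutive edges, all belonging to `E`. -/
def InfPath {V : Type} (E : Set (V × ℤ × V)) (π : ℕ → V × ℤ × V) : Prop :=
  (∀ i, π i ∈ E) ∧ ∀ i, (π i).2.2 = (π (i + 1)).1

/-- The total weight of a finite path. -/
def pathWeight {V : Type} (p : List (V × ℤ × V)) : ℤ :=
  (p.map fun e => e.2.1).sum

/-- A sequence of integer weights satisfies mean payoff if the liminf of the
averages of its prefixes is nonnegative. -/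
def MeanPayoffSeq (w : ℕ → ℤ) : Prop :=
  0 ≤ Filter.atTop.liminf (fun ℓ : ℕ => (∑ i ∈ Finset.range ℓ, (w i : ℝ)) / (ℓ : ℝ))

/-- A graph (given by its edge set) satisfies mean payoff if all its infinite paths do. -/
def SatMP {V : Type} (E : Set (V × ℤ × V)) : Prop :=
  ∀ π : ℕ → V × ℤ × V, InfPath E π → MeanPayoffSeq (fun i => (π i).2.1)

/-- A cycle: a nonempty finite path whose first and last vertices coincide. -/
def IsCycle {V : Type} (E : Set (V × ℤ × V)) (p : List (V × ℤ × V)) : Prop :=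
  p ≠ [] ∧ ∃ v, FinPath E v p ∧ lastV v p = v

/-- A `W`-graph: a finite set of vertices, edges labelled by weights in `W`,
and an initial vertex from which every vertex is reachable. -/
structure WGraph (W : Finset ℤ) where
  V : Type
  fin : Fintype V
  E : Set (V × ℤ × V)
  init : V
  wt : ∀ e ∈ E, e.2.1 ∈ W
  reach : ∀ v : V, ∃ p, FinPath E init p ∧ lastV init p = v

attribute [instance] WGraph.fin

/-- A mean payoff game: a `W`-graph together with a set of vertices controlled by Eve
(the remaining vertices being controlled by Adam), where every vertex has an
outgoing edge. -/
structure MPGame (W : Finset ℤ) extends WGraph W where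
  EveV : Set V
  succ_exists : ∀ v : V, ∃ e ∈ E, e.1 = v

/-- A strategy for Eve: maps finite paths from the initial vertex (ending in a
vertex controlled by Eve) to an edge whose source is the last vertex of the path. -/
structure Strategy {W : Finset ℤ} (G : MPGame W) where
  f : List (G.V × ℤ × G.V) → G.V × ℤ × G.V
  valid : ∀ p, FinPath G.E G.init p → lastV G.init p ∈ G.EveV →
    f p ∈ G.E ∧ (f p).1 = lastV G.init p

/-- A positional strategy for Eve. -/
structure PosStrategy {W : Finset ℤ} (G : MPGame W) where
  f : G.V → G.V × ℤ × G.V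
  valid : ∀ v ∈ G.EveV, f v ∈ G.E ∧ (f v).1 = v

/-- The strategy induced by a positional strategy: it only looks at the last vertex. -/
def PosStrategy.induced {W : Finset ℤ} {G : MPGame W} (σ : PosStrategy G) :
    Strategy G where
  f := fun p => σ.f (lastV G.init p)
  valid := fun p _ hv => σ.valid _ hv

/-- An infinite path from the initial vertex consistent with a strategy. -/
def ConsistentPath {W : Finset ℤ} {G : MPGame W} (σ : Strategy G)
    (π : ℕ → G.V × ℤ × G.V) : Prop :=
  InfPath G.E π ∧ (π 0).1 = G.init ∧
    ∀ i, (π i).1 ∈ G.EveV → σ.f ((List.range i).map π) = π i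

/-- A strategy ensures mean payoff if every consistent infinite path from the
initial vertex satisfies mean payoff. -/
def EnsuresMP {W : Finset ℤ} {G : MPGame W} (σ : Strategy G) : Prop :=
  ∀ π, ConsistentPath σ π → MeanPayoffSeq (fun i => (π i).2.1)

/-- A deterministic safety automaton over the alphabet `W`. -/
structure SafetyAut (W : Finset ℤ) where
  Q : Type
  fin : Fintype Q
  bot : Q
  qinit : Q
  δ : Q → ℤ → Q
  bot_absorbing : ∀ w ∈ W, δ bot w = bot

attribute [instance] SafetyAut.fin

/-- The run of the automaton over an infinite word. -/
def SafetyAut.run {W : Finset ℤ} (A : SafetyAut W) (w : ℕ → ℤ) : ℕ → A.Q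
  | 0 => A.qinit
  | i + 1 => A.δ (A.run w i) (w i)

/-- The language of the automaton: words over `W` whose run never visits `⊥`. -/
def SafetyAut.Lang {W : Finset ℤ} (A : SafetyAut W) : Set (ℕ → ℤ) :=
  {w | (∀ i, w i ∈ W) ∧ ∀ i, A.run w i ≠ A.bot}

/-- `MP(W)`: the set of infinite words over `W` satisfying mean payoff. -/
def MPlang (W : Finset ℤ) : Set (ℕ → ℤ) :=
  {w | (∀ i, w i ∈ W) ∧ MeanPayoffSeq w}

/-- `MP_n(W)`: the set of weight sequences of infinite paths of `(n,W)`-graphs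
satisfying mean payoff. -/
def MPn (n : ℕ) (W : Finset ℤ) : Set (ℕ → ℤ) :=
  {w | ∃ G : WGraph W, Fintype.card G.V ≤ n ∧ SatMP G.E ∧
    ∃ π, InfPath G.E π ∧ ∀ i, (π i).2.1 = w i}

/-- An `(n,W)`-separating automaton: its language `L` satisfies `MP_n(W) ⊆ L ⊆ MP(W)`. -/
def Separating {W : Finset ℤ} (n : ℕ) (A : SafetyAut W) : Prop :=
  MPn n W ⊆ A.Lang ∧ A.Lang ⊆ MPlang W

/-- A strategy ensures the language `L` if every consistent infinite path from the
initial vertex has its sequence of weights in `L`. -/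
def EnsuresLang {W : Finset ℤ} {G : MPGame W} (σ : Strategy G) (L : Set (ℕ → ℤ)) : Prop :=
  ∀ π, ConsistentPath σ π → (fun i => (π i).2.1) ∈ L

/-- Finite paths in an unlabelled graph. -/
def FinPathU {V : Type} (E : Set (V × V)) (u : V) (p : List (V × V)) : Prop :=
  (∀ e ∈ p, e ∈ E) ∧ List.Chain' (fun e e' => e.2 = e'.1) p ∧
    ∀ h : p ≠ [], (p.head h).1 = u

def lastVU {V : Type} (u : V) (p : List (V × V)) : V :=
  (p.getLastD (u, u)).2

/-- Infinite paths in an unlabelled graph. -/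
def InfPathU {V : Type} (E : Set (V × V)) (π : ℕ → V × V) : Prop :=
  (∀ i, π i ∈ E) ∧ ∀ i, (π i).2 = (π (i + 1)).1

/-- A safety game: an unlabelled finite directed game graph. -/
structure SafetyGame where
  V : Type
  fin : Fintype V
  E : Set (V × V)
  init : V
  EveV : Set V
  succ_exists : ∀ v : V, ∃ e ∈ E, e.1 = v

/-- A strategy of Eve in a safety game. -/
structure UStrategy (S : SafetyGame) where
  f : List (S.V × S.V) → S.V × S.V
  valid : ∀ p, FinPathU S.E S.init p → lastVU S.init p ∈ S.EveV →
    f p ∈ S.E ∧ (f p).1 = lastVU S.init p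

/-- An infinite path from the initial vertex consistent with a strategy. -/
def UConsistent {S : SafetyGame} (σ : UStrategy S) (π : ℕ → S.V × S.V) : Prop :=
  InfPathU S.E π ∧ (π 0).1 = S.init ∧
    ∀ i, (π i).1 ∈ S.EveV → σ.f ((List.range i).map π) = π i

/-- A strategy ensures safety w.r.t. a set `Bad` of vertices if no consistent
infinite path from the initial vertex ever visits a vertex of `Bad`. -/
def EnsuresSafety {S : SafetyGame} (σ : UStrategy S) (Bad : Set S.V) : Prop :=
  ∀ π, UConsistent σ π → ∀ i, (π i).1 ∉ Bad

/-- The product safety game `G × A` of a mean payoff game and a deterministic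
safety automaton. -/
def prodGame {W : Finset ℤ} (G : MPGame W) (A : SafetyAut W) : SafetyGame where
  V := G.V × A.Q
  fin := inferInstance
  E := {e | ∃ v w v' q, (v, w, v') ∈ G.E ∧ e = ((v, q), (v', A.δ q w))}
  init := (G.init, A.qinit)
  EveV := {x | x.1 ∈ G.EveV}
  succ_exists := by
    rintro ⟨v, q⟩
    obtain ⟨e, he, h1⟩ := G.succ_exists v
    exact ⟨((v, q), (e.2.2, A.δ q e.2.1)), ⟨v, e.2.1, e.2.2, q, by rw [← h1]; exact he, rfl⟩, rfl⟩

/-! ### Mean payoff of bounded sequences -/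

theorem abs_average_le {w : ℕ → ℤ} {M : ℝ} (hw : ∀ i, |(w i : ℝ)| ≤ M) (ℓ : ℕ) :
    |(∑ i ∈ Finset.range ℓ, (w i : ℝ)) / (ℓ : ℝ)| ≤ M := by
  have hM : 0 ≤ M := (abs_nonneg _).trans (hw 0)
  rw [abs_div, Nat.abs_cast]
  refine div_le_of_le_mul₀ (Nat.cast_nonneg ℓ) hM ?_
  calc |∑ i ∈ Finset.range ℓ, (w i : ℝ)| ≤ ∑ i ∈ Finset.range ℓ, |(w i : ℝ)| :=
        Finset.abs_sum_le_sum_abs _ _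
    _ ≤ ∑ _i ∈ Finset.range ℓ, M := Finset.sum_le_sum fun i _ => hw i
    _ = M * ℓ := by simp [mul_comm]

theorem meanPayoffSeq_of_sum_ge {w : ℕ → ℤ} {M : ℝ} (hw : ∀ i, |(w i : ℝ)| ≤ M)
    (h : ∀ ε > 0, ∃ C : ℝ, ∀ ℓ : ℕ, -C - ε * ℓ ≤ ∑ i ∈ Finset.range ℓ, (w i : ℝ)) :
    MeanPayoffSeq w := by
  have hcob : IsCoboundedUnder (· ≥ ·) atTop
      (fun ℓ : ℕ => (∑ i ∈ Finset.range ℓ, (w i : ℝ)) / (ℓ : ℝ)) :=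
    (isBoundedUnder_of ⟨M, fun ℓ => (abs_le.1 (abs_average_le hw ℓ)).2⟩).isCoboundedUnder_ge
  refine le_of_forall_lt fun c hc => ?_
  obtain ⟨C, hC⟩ := h (-c / 4) (by linarith)
  refine lt_of_lt_of_le (show c < c / 2 by linarith) (le_liminf_of_le hcob ?_)
  have hlarge := (tendsto_natCast_atTop_atTop (R := ℝ)).eventually_ge_atTop (C / (-c / 4))
  filter_upwards [hlarge, eventually_gt_atTop 0] with ℓ hℓ hpos
  have hpos' : (0 : ℝ) < ℓ := Nat.cast_pos.2 hpos
  rw [div_le_iff₀ (by linarith)] at hℓ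
  rw [le_div_iff₀ hpos']
  linarith [hC ℓ]

theorem not_meanPayoffSeq_of_sum_le {w : ℕ → ℤ} {M : ℝ} (hw : ∀ i, |(w i : ℝ)| ≤ M)
    {C δ : ℝ} (hδ : 0 < δ)
    (h : ∀ ℓ : ℕ, ∑ i ∈ Finset.range ℓ, (w i : ℝ) ≤ C - δ * ℓ) : ¬ MeanPayoffSeq w := by
  intro hmp
  have hbdd : IsBoundedUnder (· ≥ ·) atTop
      (fun ℓ : ℕ => (∑ i ∈ Finset.range ℓ, (w i : ℝ)) / (ℓ : ℝ)) :=
    isBoundedUnder_of ⟨-M, fun ℓ => (abs_le.1 (abs_average_le hw ℓ)).1⟩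
  have hev := eventually_lt_of_lt_liminf (lt_of_lt_of_le (show -(δ / 2) < 0 by linarith) hmp) hbdd
  have hlarge := (tendsto_natCast_atTop_atTop (R := ℝ)).eventually_ge_atTop (C / (δ / 2))
  obtain ⟨ℓ, hlt, hℓ, hpos⟩ := (hev.and (hlarge.and (eventually_gt_atTop 0))).exists
  have hpos' : (0 : ℝ) < ℓ := Nat.cast_pos.2 hpos
  rw [div_le_iff₀ (by linarith)] at hℓ
  rw [lt_div_iff₀ hpos'] at hlt
  linarith [h ℓ]

/-! ### Discounted games and their limit -/

/-- A finite discounted game has values, attained by a positional choice `c` of edges that is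
optimal for both players. -/
theorem exists_discounted_value {V ι : Type} [Fintype V] [Fintype ι] (src dst : ι → V)
    (wt : ι → ℝ) (Eve : Set V) (hsrc : Function.Surjective src) {M : ℝ} (hM₀ : 0 ≤ M)
    (hM : ∀ e, |wt e| ≤ M) {r : ℝ} (h0 : 0 ≤ r) (h1 : r < 1) :
    ∃ (v : V → ℝ) (c : V → ι), ‖v‖ ≤ M ∧ (∀ s, src (c s) = s) ∧
      (∀ s, v s = (1 - r) * wt (c s) + r * v (dst (c s))) ∧
      (∀ e, src e ∈ Eve → (1 - r) * wt e + r * v (dst e) ≤ v (src e)) ∧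
      (∀ e, src e ∉ Eve → v (src e) ≤ (1 - r) * wt e + r * v (dst e)) := by
  classical
  let out : V → Finset ι := fun s => Finset.univ.filter fun e => src e = s
  have hout : ∀ s, (out s).Nonempty := fun s => by
    obtain ⟨e, he⟩ := hsrc s
    exact ⟨e, by simp [out, he]⟩
  let gain : (V → ℝ) → ι → ℝ := fun v e => (1 - r) * wt e + r * v (dst e)
  let T : (V → ℝ) → V → ℝ := fun v s =>
    if s ∈ Eve then (out s).sup' (hout s) (gain v) else (out s).inf' (hout s) (gain v)
  have hgain : ∀ v v' e, gain v e ≤ gain v' e + r * dist v v' := by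
    intro v v' e
    have hd : v (dst e) - v' (dst e) ≤ dist v v' :=
      (le_abs_self _).trans (dist_le_pi_dist v v' (dst e))
    have := mul_le_mul_of_nonneg_left hd h0
    simp only [gain]
    linarith
  have hT : ∀ v v' s, T v s ≤ T v' s + r * dist v v' := by
    intro v v' s
    by_cases hs : s ∈ Eve
    · simp only [T, if_pos hs]
      refine Finset.sup'_le _ _ fun e he => (hgain v v' e).trans ?_
      have := Finset.le_sup' (gain v') he
      linarith
    · simp only [T, if_neg hs]
      rw [← sub_le_iff_le_add]
      refine Finset.le_inf' _ _ fun e he => ?_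
      have := Finset.inf'_le (gain v) he
      linarith [hgain v v' e]
  have hcontr : ContractingWith ⟨r, h0⟩ T := by
    refine ⟨by exact_mod_cast h1, LipschitzWith.of_dist_le_mul fun v v' => ?_⟩
    refine (dist_pi_le_iff (by positivity)).2 fun s => ?_
    have h₁ := hT v v' s
    have h₂ := hT v' v s
    rw [dist_comm v' v] at h₂
    rw [Real.dist_eq, abs_le]
    change -(r * dist v v') ≤ _ ∧ _ ≤ r * dist v v'
    constructor <;> linarith
  let v := hcontr.fixedPoint T
  have hv : T v = v := hcontr.fixedPoint_isFixedPt
  have hc : ∀ s, ∃ e, src e = s ∧ v s = gain v e := by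
    intro s
    rw [← congrFun hv s]
    by_cases hs : s ∈ Eve
    · obtain ⟨e, he, h⟩ := Finset.exists_mem_eq_sup' (hout s) (gain v)
      exact ⟨e, by simpa [out] using he, by simp only [T, if_pos hs, h]⟩
    · obtain ⟨e, he, h⟩ := Finset.exists_mem_eq_inf' (hout s) (gain v)
      exact ⟨e, by simpa [out] using he, by simp only [T, if_neg hs, h]⟩
  choose c hc hcv using hc
  refine ⟨v, c, ?_, hc, hcv, fun e he => ?_, fun e he => ?_⟩
  · have hle : ‖v‖ ≤ (1 - r) * M + r * ‖v‖ := by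
      refine (pi_norm_le_iff_of_nonneg ?_).2 fun s => ?_
      · have : 0 ≤ 1 - r := by linarith
        positivity
      · rw [hcv s, Real.norm_eq_abs]
        have a₁ := abs_le.1 (hM (c s))
        have a₂ := abs_le.1 (norm_le_pi_norm v (dst (c s)))
        simp only [gain]
        rw [abs_le]
        constructor <;> nlinarith
    nlinarith
  · rw [← congrFun hv (src e)]
    simp only [T, if_pos he]
    exact Finset.le_sup' (gain v) (by simp [out])
  · rw [← congrFun hv (src e)]
    simp only [T, if_neg he]
    exact Finset.inf'_le (gain v) (by simp [out])

/-- A finite game has mean payoff values `g`, together with a positional choice `c` of edges which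
is optimal for both players, as witnessed by potentials `u` up to arbitrary `ε > 0`. -/
theorem exists_meanPayoff_value {V ι : Type} [Fintype V] [Fintype ι] (src dst : ι → V)
    (wt : ι → ℝ) (Eve : Set V) (hsrc : Function.Surjective src) {M : ℝ} (hM₀ : 0 ≤ M)
    (hM : ∀ e, |wt e| ≤ M) :
    ∃ (g : V → ℝ) (c : V → ι), (∀ s, src (c s) = s) ∧
      (∀ e, src e ∉ Eve ∨ c (src e) = e → g (src e) ≤ g (dst e)) ∧
      (∀ e, src e ∈ Eve ∨ c (src e) = e → g (dst e) ≤ g (src e)) ∧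
      ∀ ε > 0, ∃ u : V → ℝ,
        (∀ e, src e ∉ Eve ∨ c (src e) = e → u (src e) - u (dst e) + g (dst e) - ε ≤ wt e) ∧
        (∀ e, src e ∈ Eve ∨ c (src e) = e → wt e ≤ u (src e) - u (dst e) + g (dst e) + ε) := by
  classical
  let r : ℕ → ℝ := fun k => 1 - 1 / ((k : ℝ) + 1)
  have hr0 : ∀ k, 0 ≤ r k := fun k => by
    have : 1 / ((k : ℝ) + 1) ≤ 1 := by
      rw [div_le_one (by positivity)]
      linarith [(Nat.cast_nonneg k : (0 : ℝ) ≤ k)]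
    simp only [r]
    linarith
  have hr1 : ∀ k, r k < 1 := fun k => by
    have : 0 < 1 / ((k : ℝ) + 1) := by positivity
    simp only [r]
    linarith
  have hr : Tendsto r atTop (nhds 1) := by
    simpa [r] using (tendsto_const_nhds (x := (1 : ℝ))).sub
      (tendsto_one_div_add_atTop_nhds_zero_nat (𝕜 := ℝ))
  choose v c hvM hc hcv hE hA using fun k =>
    exists_discounted_value src dst wt Eve hsrc hM₀ hM (hr0 k) (hr1 k)
  obtain ⟨c₀, hc₀⟩ : ∃ c₀, ∃ᶠ k in atTop, c k = c₀ := by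
    by_contra hcon
    simp only [not_exists, not_frequently] at hcon
    obtain ⟨k, hk⟩ := (eventually_all.2 hcon).exists
    exact hk (c k) rfl
  obtain ⟨φ, hφ, hφc⟩ := extraction_of_frequently_atTop hc₀
  obtain ⟨g, -, ψ, hψ, hg⟩ := tendsto_subseq_of_bounded (x := fun k => v (φ k))
    (Metric.isBounded_closedBall (x := (0 : V → ℝ)) (r := M))
    (fun k => by simpa using hvM (φ k))
  have hθ : Tendsto (fun k => φ (ψ k)) atTop atTop := hφ.tendsto_atTop.comp hψ.tendsto_atTop
  have hgs : ∀ s, Tendsto (fun k => v (φ (ψ k)) s) atTop (nhds (g s)) :=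
    fun s => (tendsto_pi_nhds.1 hg) s
  have hgain : ∀ e, Tendsto (fun k => (1 - r (φ (ψ k))) * wt e + r (φ (ψ k)) * v (φ (ψ k)) (dst e))
      atTop (nhds (g (dst e))) := fun e => by
    simpa using ((tendsto_const_nhds (x := (1 : ℝ))).sub (hr.comp hθ)).mul_const (wt e) |>.add
      ((hr.comp hθ).mul (hgs (dst e)))
  have hlow : ∀ k e, src e ∉ Eve ∨ c₀ (src e) = e →
      v (φ (ψ k)) (src e) ≤ (1 - r (φ (ψ k))) * wt e + r (φ (ψ k)) * v (φ (ψ k)) (dst e) := by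
    rintro k e (he | he)
    · exact hA _ e he
    · have := hcv (φ (ψ k)) (src e)
      rw [hφc, he] at this
      exact this.le
  have hupp : ∀ k e, src e ∈ Eve ∨ c₀ (src e) = e →
      (1 - r (φ (ψ k))) * wt e + r (φ (ψ k)) * v (φ (ψ k)) (dst e) ≤ v (φ (ψ k)) (src e) := by
    rintro k e (he | he)
    · exact hE _ e he
    · have := hcv (φ (ψ k)) (src e)
      rw [hφc, he] at this
      exact this.ge
  refine ⟨g, c₀, fun s => ?_, fun e he => ?_, fun e he => ?_, fun ε hε => ?_⟩
  · rw [← hφc 0]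
    exact hc _ s
  · exact le_of_tendsto_of_tendsto' (hgs _) (hgain e) fun k => hlow k e he
  · exact le_of_tendsto_of_tendsto' (hgain e) (hgs _) fun k => hupp k e he
  · obtain ⟨k, hk⟩ := (eventually_all.2 fun s => Metric.tendsto_nhds.1 (hgs s) ε hε).exists
    have hpos : 0 < 1 - r (φ (ψ k)) := by linarith [hr1 (φ (ψ k))]
    refine ⟨fun s => v (φ (ψ k)) s / (1 - r (φ (ψ k))), fun e he => ?_, fun e he => ?_⟩
    · have h₁ := hlow k e he
      have h₂ := (abs_lt.1 (Real.dist_eq _ _ ▸ hk (dst e))).1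
      have h₃ : v (φ (ψ k)) (src e) / (1 - r (φ (ψ k))) - v (φ (ψ k)) (dst e) / (1 - r (φ (ψ k)))
          + v (φ (ψ k)) (dst e) ≤ wt e := by
        rw [← sub_div, ← le_sub_iff_add_le, div_le_iff₀ hpos]
        linarith
      linarith
    · have h₁ := hupp k e he
      have h₂ := (abs_lt.1 (Real.dist_eq _ _ ▸ hk (dst e))).2
      have h₃ : wt e ≤ v (φ (ψ k)) (src e) / (1 - r (φ (ψ k)))
          - v (φ (ψ k)) (dst e) / (1 - r (φ (ψ k))) + v (φ (ψ k)) (dst e) := by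
        rw [← sub_div, ← sub_le_iff_le_add, le_div_iff₀ hpos]
        linarith
      linarith

/-! ### Paths -/

theorem lastV_concat {V : Type} (u : V) (p : List (V × ℤ × V)) (e : V × ℤ × V) :
    lastV u (p ++ [e]) = e.2.2 := by
  simp [lastV]

theorem FinPath.concat {V : Type} {E : Set (V × ℤ × V)} {u : V} {p : List (V × ℤ × V)}
    {e : V × ℤ × V} (hp : FinPath E u p) (he : e ∈ E) (hs : e.1 = lastV u p) :
    FinPath E u (p ++ [e]) := by
  refine ⟨?_, ?_, ?_⟩
  · intro e' he'
    rcases List.mem_append.1 he' with h | h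
    · exact hp.1 e' h
    · rwa [List.mem_singleton.1 h]
  · refine List.isChain_append.2 ⟨hp.2.1, List.isChain_singleton e, ?_⟩
    rcases List.eq_nil_or_concat p with rfl | ⟨q, f, rfl⟩
    · simp
    · simpa [lastV] using hs.symm
  · intro _
    cases p with
    | nil => simpa [lastV] using hs
    | cons a q => simpa using hp.2.2 (by simp)

theorem finPath_nil {V : Type} (E : Set (V × ℤ × V)) (u : V) : FinPath E u [] :=
  ⟨by simp, List.isChain_nil, fun h => absurd rfl h⟩

theorem lastV_map_range {V : Type} {E : Set (V × ℤ × V)} {π : ℕ → V × ℤ × V}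
    (h : InfPath E π) (i : ℕ) : lastV (π 0).1 ((List.range i).map π) = (π i).1 := by
  cases i with
  | zero => simp [lastV]
  | succ i => simp [List.range_succ, lastV, h.2 i]

theorem lastVU_map_range {V : Type} {E : Set (V × V)} {π : ℕ → V × V}
    (h : InfPathU E π) (i : ℕ) : lastVU (π 0).1 ((List.range i).map π) = (π i).1 := by
  cases i with
  | zero => simp [lastVU]
  | succ i => simp [List.range_succ, lastVU, h.2 i]

/-- A sequence of edges, each starting where the previous ones lead from `u`, yields finite paths
as prefixes. -/
theorem finPathU_map_range {V : Type} {E : Set (V × V)} {π : ℕ → V × V}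
    {i : ℕ} (hE : ∀ j < i, π j ∈ E) (h : ∀ j < i, (π j).2 = (π (j + 1)).1) :
    FinPathU E (π 0).1 ((List.range i).map π) := by
  refine ⟨by simpa using hE, ?_, ?_⟩
  · refine List.isChain_iff_getElem.2 fun j hj => ?_
    simp only [List.length_map, List.length_range] at hj
    simpa using h j (by omega)
  · intro hne
    cases i with
    | zero => simp at hne
    | succ i => simp [List.head_map, List.head_range]

/-- The graph induced by a set of edges on the vertices reachable from `init`. -/
noncomputable def reachableGraph {V : Type} [Fintype V] (W : Finset ℤ) (E : Set (V × ℤ × V))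
    (init : V) (wt : ∀ e ∈ E, e.2.1 ∈ W) : WGraph W where
  V := {v : V // Relation.ReflTransGen (fun a b => ∃ w, (a, w, b) ∈ E) init v}
  fin := Fintype.ofFinite _
  E := {e | (e.1.1, e.2.1, e.2.2.1) ∈ E}
  init := ⟨init, .refl⟩
  wt := fun _ he => wt _ he
  reach := by
    rintro ⟨v, hv⟩
    induction hv with
    | refl => exact ⟨[], finPath_nil _ _, rfl⟩
    | @tail b v hb hv ih =>
      obtain ⟨p, hp, hl⟩ := ih
      obtain ⟨w, hw⟩ := hv
      refine ⟨p ++ [(⟨b, hb⟩, w, ⟨v, hb.tail ⟨w, hw⟩⟩)], hp.concat ?_ hl.symm, lastV_concat _ _ _⟩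
      exact hw

theorem card_reachableGraph_le {V : Type} [Fintype V] (W : Finset ℤ) (E : Set (V × ℤ × V))
    (init : V) (wt : ∀ e ∈ E, e.2.1 ∈ W) :
    Fintype.card (reachableGraph W E init wt).V ≤ Fintype.card V :=
  Fintype.card_le_of_injective (fun v : (reachableGraph W E init wt).V => v.1)
    Subtype.val_injective

/-! ### Positional determinacy of mean payoff games -/

theorem exists_abs_le_of_mem (W : Finset ℤ) : ∃ M : ℝ, 0 ≤ M ∧ ∀ w ∈ W, |(w : ℝ)| ≤ M :=
  ⟨∑ w ∈ W, |(w : ℝ)|, Finset.sum_nonneg fun _ _ => abs_nonneg _,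
    fun _ hw => Finset.single_le_sum (f := fun w : ℤ => |(w : ℝ)|) (fun _ _ => abs_nonneg _) hw⟩

theorem MPGame.finite_edges {W : Finset ℤ} (G : MPGame W) : G.E.Finite := by
  refine (Set.Finite.prod (Set.finite_univ (α := G.V))
    (W.finite_toSet.prod (Set.finite_univ (α := G.V)))).subset fun e he => ?_
  exact ⟨trivial, G.wt e he, trivial⟩

/-- The edges compatible with a positional strategy. -/
def PosStrategy.edges {W : Finset ℤ} {G : MPGame W} (ρ : PosStrategy G) :
    Set (G.V × ℤ × G.V) :=
  {e ∈ G.E | e.1 ∈ G.EveV → ρ.f e.1 = e}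

/-- Every strategy `σ` has a consistent path using the edges chosen by `c` at Adam's vertices. -/
theorem Strategy.exists_consistentPath {W : Finset ℤ} {G : MPGame W} (σ : Strategy G)
    (c : G.V → G.V × ℤ × G.V) (hcE : ∀ s, c s ∈ G.E) (hc : ∀ s, (c s).1 = s) :
    ∃ π, ConsistentPath σ π ∧ ∀ i, (π i).1 ∈ G.EveV ∨ c (π i).1 = π i := by
  classical
  let next : List (G.V × ℤ × G.V) → G.V × ℤ × G.V := fun p =>
    if lastV G.init p ∈ G.EveV then σ.f p else c (lastV G.init p)
  let hist : ℕ → List (G.V × ℤ × G.V) := Nat.rec [] fun _ p => p ++ [next p]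
  have hnext : ∀ p, FinPath G.E G.init p →
      next p ∈ G.E ∧ (next p).1 = lastV G.init p := by
    intro p hp
    by_cases h : lastV G.init p ∈ G.EveV
    · simpa only [next, if_pos h] using σ.valid p hp h
    · simp only [next, if_neg h]
      exact ⟨hcE _, hc _⟩
  have hpath : ∀ i, FinPath G.E G.init (hist i) := by
    intro i
    induction i with
    | zero => exact finPath_nil _ _
    | succ i ih => exact ih.concat (hnext _ ih).1 (hnext _ ih).2
  have hmap : ∀ i, (List.range i).map (fun j => next (hist j)) = hist i := by
    intro i
    induction i with
    | zero => rfl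
    | succ i ih => rw [List.range_succ, List.map_append, ih]; rfl
  refine ⟨fun i => next (hist i), ⟨⟨fun i => (hnext _ (hpath i)).1, fun i => ?_⟩, ?_, ?_⟩, ?_⟩
  · rw [(hnext _ (hpath (i + 1))).2]
    exact (lastV_concat _ _ _).symm
  · exact (hnext _ (hpath 0)).2
  · intro i hi
    rw [hmap]
    rw [(hnext _ (hpath i)).2] at hi
    simp only [next, if_pos hi]
  · intro i
    rw [(hnext _ (hpath i)).2]
    by_cases hi : lastV G.init (hist i) ∈ G.EveV
    · exact .inl hi
    · exact .inr (by simp only [next, if_neg hi])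

/-- If Eve has a strategy ensuring mean payoff, then she has a positional strategy such that every
infinite path using its edges from a reachable vertex satisfies mean payoff. -/
theorem exists_posStrategy_of_ensuresMP {W : Finset ℤ} {G : MPGame W} (σ : Strategy G)
    (hσ : EnsuresMP σ) :
    ∃ (ρ : PosStrategy G) (S : Set G.V), G.init ∈ S ∧
      (∀ e ∈ ρ.edges, e.1 ∈ S → e.2.2 ∈ S) ∧
      ∀ π, InfPath ρ.edges π → (π 0).1 ∈ S → MeanPayoffSeq fun i => (π i).2.1 := by
  classical
  obtain ⟨M, hM₀, hM⟩ := exists_abs_le_of_mem W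
  have : Fintype G.E := G.finite_edges.fintype
  obtain ⟨g, c, hc, hlow, hupp, hpot⟩ := exists_meanPayoff_value
    (fun e : G.E => e.1.1) (fun e : G.E => e.1.2.2) (fun e : G.E => (e.1.2.1 : ℝ)) G.EveV
    (fun s => by
      obtain ⟨e, he, hs⟩ := G.succ_exists s
      exact ⟨⟨e, he⟩, hs⟩) hM₀ (fun e => hM _ (G.wt _ e.2))
  refine ⟨⟨fun s => (c s).1, fun s _ => ⟨(c s).2, hc s⟩⟩, {s | 0 ≤ g s}, ?_, ?_, ?_⟩
  · by_contra hneg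
    simp only [Set.mem_ofPred_eq, not_le] at hneg
    obtain ⟨π, hπ, hAdam⟩ := σ.exists_consistentPath (fun s => (c s).1) (fun s => (c s).2) hc
    obtain ⟨u, -, hu⟩ := hpot (-g G.init / 2) (by linarith)
    have hedge : ∀ i, (π i).1 ∈ G.EveV ∨ c (π i).1 = ⟨π i, hπ.1.1 i⟩ :=
      fun i => (hAdam i).imp_right fun h => Subtype.ext h
    have hg : ∀ i, g (π i).1 ≤ g G.init := by
      intro i
      induction i with
      | zero => rw [hπ.2.1]
      | succ i ih =>
        rw [← hπ.1.2 i]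
        exact (hupp ⟨π i, hπ.1.1 i⟩ (hedge i)).trans ih
    have hsum : ∀ ℓ : ℕ, ∑ i ∈ Finset.range ℓ, ((π i).2.1 : ℝ)
        ≤ u (π 0).1 - u (π ℓ).1 - (-g G.init / 2) * ℓ := by
      intro ℓ
      induction ℓ with
      | zero => simp
      | succ ℓ ih =>
        have h := hu ⟨π ℓ, hπ.1.1 ℓ⟩ (hedge ℓ)
        simp only [hπ.1.2 ℓ] at h
        rw [Finset.sum_range_succ]
        push_cast
        linarith [hg (ℓ + 1)]
    refine not_meanPayoffSeq_of_sum_le (fun i => hM _ (G.wt _ (hπ.1.1 i)))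
      (C := u (π 0).1 + ‖u‖) (δ := -g G.init / 2) (by linarith) (fun ℓ => ?_) (hσ π hπ)
    have := (abs_le.1 (norm_le_pi_norm u (π ℓ).1)).1
    linarith [hsum ℓ]
  · intro e he h0
    exact le_trans h0 (hlow ⟨e, he.1⟩ (or_iff_not_imp_left.2 fun h =>
      Subtype.ext (he.2 (not_not.1 h))))
  · intro π hπ h0
    have hedge : ∀ i, (π i).1 ∉ G.EveV ∨ c (π i).1 = ⟨π i, (hπ.1 i).1⟩ :=
      fun i => or_iff_not_imp_left.2 fun h => Subtype.ext ((hπ.1 i).2 (not_not.1 h))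
    have hg : ∀ i, 0 ≤ g (π i).1 := by
      intro i
      induction i with
      | zero => exact h0
      | succ i ih =>
        rw [← hπ.2 i]
        exact ih.trans (hlow ⟨π i, (hπ.1 i).1⟩ (hedge i))
    refine meanPayoffSeq_of_sum_ge (fun i => hM _ (G.wt _ (hπ.1 i).1)) fun ε hε => ?_
    obtain ⟨u, hu, -⟩ := hpot ε hε
    have hsum : ∀ ℓ : ℕ, u (π 0).1 - u (π ℓ).1 - ε * ℓ
        ≤ ∑ i ∈ Finset.range ℓ, ((π i).2.1 : ℝ) := by
      intro ℓ
      induction ℓ with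
      | zero => simp
      | succ ℓ ih =>
        have h := hu ⟨π ℓ, (hπ.1 ℓ).1⟩ (hedge ℓ)
        simp only [hπ.2 ℓ] at h
        rw [Finset.sum_range_succ]
        push_cast
        linarith [hg (ℓ + 1)]
    refine ⟨‖u‖ - u (π 0).1, fun ℓ => ?_⟩
    have := (abs_le.1 (norm_le_pi_norm u (π ℓ).1)).2
    linarith [hsum ℓ]

/-- If Eve has a strategy ensuring mean payoff in an `(n,W)`-game, then she has a positional
strategy all of whose plays have their weight sequence in `MP_n(W)`. -/
theorem exists_posStrategy_mem_MPn {W : Finset ℤ} {n : ℕ} {G : MPGame W}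
    (hG : Fintype.card G.V ≤ n) (σ : Strategy G) (hσ : EnsuresMP σ) :
    ∃ ρ : PosStrategy G, ∀ π, InfPath ρ.edges π → (π 0).1 = G.init →
      (fun i => (π i).2.1) ∈ MPn n W := by
  obtain ⟨ρ, S, hinit, hS, hMP⟩ := exists_posStrategy_of_ensuresMP σ hσ
  refine ⟨ρ, fun π hπ h0 => ?_⟩
  let H := reachableGraph W ρ.edges G.init fun e he => G.wt e he.1
  have hreach : ∀ i, Relation.ReflTransGen (fun a b => ∃ w, (a, w, b) ∈ ρ.edges)
      G.init (π i).1 := by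
    intro i
    induction i with
    | zero => rw [h0]
    | succ i ih =>
      rw [← hπ.2 i]
      exact ih.tail ⟨(π i).2.1, hπ.1 i⟩
  have hreach' : ∀ i, Relation.ReflTransGen (fun a b => ∃ w, (a, w, b) ∈ ρ.edges)
      G.init (π i).2.2 := fun i => hπ.2 i ▸ hreach (i + 1)
  refine ⟨H, (card_reachableGraph_le W _ _ _).trans hG, fun π' hπ' => ?_,
    fun i => (⟨(π i).1, hreach i⟩, (π i).2.1, ⟨(π i).2.2, hreach' i⟩),
    ⟨fun i => hπ.1 i, fun i => Subtype.ext (hπ.2 i)⟩, fun _ => rfl⟩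
  refine hMP (fun i => ((π' i).1.1, (π' i).2.1, (π' i).2.2.1))
    ⟨fun i => hπ'.1 i, fun i => congrArg Subtype.val (hπ'.2 i)⟩ ?_
  change (π' 0).1.1 ∈ S
  have hmem : ∀ v, Relation.ReflTransGen (fun a b => ∃ w, (a, w, b) ∈ ρ.edges) G.init v →
      v ∈ S := fun v hv => by
    induction hv with
    | refl => exact hinit
    | tail _ h ih => exact hS _ h.choose_spec ih
  exact hmem _ (π' 0).1.2

/-! ### Product with an automaton -/

/-- The edge of the product game lifting the edge `e` from the state `q`. -/
def liftEdge {W : Finset ℤ} {V : Type} (A : SafetyAut W) (q : A.Q) (e : V × ℤ × V) :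
    (V × A.Q) × (V × A.Q) :=
  ((e.1, q), (e.2.2, A.δ q e.2.1))

theorem mem_prodGame_edges {W : Finset ℤ} {G : MPGame W} {A : SafetyAut W}
    {x : (G.V × A.Q) × (G.V × A.Q)} :
    x ∈ (prodGame G A).E ↔ ∃ e ∈ G.E, liftEdge A x.1.2 e = x := by
  constructor
  · rintro ⟨v, w, v', q, h, rfl⟩
    exact ⟨(v, w, v'), h, rfl⟩
  · rintro ⟨e, he, h⟩
    exact ⟨e.1, e.2.1, e.2.2, x.1.2, he, h.symm⟩

/-- The lift to the product game of a finite path, starting from the state `q`. -/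
def liftPath {W : Finset ℤ} {V : Type} (A : SafetyAut W) :
    A.Q → List (V × ℤ × V) → List ((V × A.Q) × (V × A.Q))
  | _, [] => []
  | q, e :: p => liftEdge A q e :: liftPath A (A.δ q e.2.1) p

theorem liftPath_concat {W : Finset ℤ} {V : Type} (A : SafetyAut W) (q : A.Q)
    (p : List (V × ℤ × V)) (e : V × ℤ × V) :
    liftPath A q (p ++ [e]) =
      liftPath A q p ++ [liftEdge A (p.foldl (fun q e => A.δ q e.2.1) q) e] := by
  induction p generalizing q with
  | nil => rfl
  | cons a p ih => simp [liftPath, ih]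

theorem foldl_map_range {W : Finset ℤ} {V : Type} (A : SafetyAut W) (π : ℕ → V × ℤ × V) (i : ℕ) :
    ((List.range i).map π).foldl (fun q e => A.δ q e.2.1) A.qinit =
      A.run (fun i => (π i).2.1) i := by
  induction i with
  | zero => rfl
  | succ i ih => rw [List.range_succ, List.map_append, List.foldl_append, ih]; rfl

theorem liftPath_map_range {W : Finset ℤ} {V : Type} (A : SafetyAut W) (π : ℕ → V × ℤ × V)
    (i : ℕ) :
    liftPath A A.qinit ((List.range i).map π) =
      (List.range i).map fun j => liftEdge A (A.run (fun i => (π i).2.1) j) (π j) := by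
  induction i with
  | zero => rfl
  | succ i ih =>
    rw [List.range_succ, List.map_append, List.map_append, ← ih, List.map_singleton,
      liftPath_concat, foldl_map_range]
    rfl

theorem InfPath.infPathU_lift {W : Finset ℤ} {G : MPGame W} (A : SafetyAut W)
    {π : ℕ → G.V × ℤ × G.V} (hπ : InfPath G.E π) :
    InfPathU (prodGame G A).E fun j => liftEdge A (A.run (fun i => (π i).2.1) j) (π j) :=
  ⟨fun i => mem_prodGame_edges.2 ⟨π i, hπ.1 i, rfl⟩,
    fun i => Prod.ext (hπ.2 i) rfl⟩

/-- A safe strategy in the product game with an automaton recognising only words satisfying mean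
payoff gives a strategy ensuring mean payoff. -/
theorem exists_ensuresMP_of_ensuresSafety {W : Finset ℤ} {G : MPGame W} {A : SafetyAut W}
    (hA : A.Lang ⊆ MPlang W) (τ : UStrategy (prodGame G A))
    (hτ : EnsuresSafety τ {x : G.V × A.Q | x.2 = A.bot}) :
    ∃ σ : Strategy G, EnsuresMP σ := by
  classical
  let Good : List (G.V × ℤ × G.V) → G.V × ℤ × G.V → Prop := fun p e =>
    e ∈ G.E ∧ e.1 = lastV G.init p ∧
      liftEdge A (p.foldl (fun q e => A.δ q e.2.1) A.qinit) e = τ.f (liftPath A A.qinit p)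
  have hf : ∀ p, ∃ e, e ∈ G.E ∧ e.1 = lastV G.init p ∧ ((∃ e', Good p e') → Good p e) := by
    intro p
    by_cases h : ∃ e', Good p e'
    · obtain ⟨e, he⟩ := h
      exact ⟨e, he.1, he.2.1, fun _ => he⟩
    · obtain ⟨e, he, hs⟩ := G.succ_exists (lastV G.init p)
      exact ⟨e, he, hs, fun h' => absurd h' h⟩
  choose f hfE hfs hfg using hf
  refine ⟨⟨f, fun p _ _ => ⟨hfE p, hfs p⟩⟩, fun π hπ => ?_⟩
  have hlift := hπ.1.infPathU_lift A
  have hinit : (liftEdge A (A.run (fun i => (π i).2.1) 0) (π 0)).1 = (prodGame G A).init :=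
    Prod.ext hπ.2.1 rfl
  have hcons : UConsistent τ fun j => liftEdge A (A.run (fun i => (π i).2.1) j) (π j) := by
    refine ⟨hlift, hinit, fun i hi => ?_⟩
    have hpath := finPathU_map_range (fun j (_ : j < i) => hlift.1 j) (fun j _ => hlift.2 j)
    have hlast := lastVU_map_range hlift i
    rw [hinit] at hpath hlast
    obtain ⟨hE, hs⟩ := τ.valid _ hpath (by rw [hlast]; exact hi)
    rw [hlast] at hs
    obtain ⟨e, he, hee⟩ := mem_prodGame_edges.1 hE
    have hgood : Good ((List.range i).map π) e := by
      have hl := lastV_map_range hπ.1 i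
      rw [hπ.2.1] at hl
      refine ⟨he, ?_, ?_⟩
      · rw [hl]
        exact congrArg (fun x => x.1.1) hee |>.trans (congrArg Prod.fst hs)
      · rw [foldl_map_range, liftPath_map_range]
        exact (congrArg (fun y : G.V × A.Q => liftEdge A y.2 e) hs).symm.trans hee
    have hg := (hfg _ ⟨e, hgood⟩).2.2
    rw [liftPath_map_range, foldl_map_range] at hg
    have hπi : f ((List.range i).map π) = π i := hπ.2.2 i hi
    exact hg.symm.trans (congrArg (liftEdge A _) hπi)
  exact (hA ⟨fun i => G.wt _ (hπ.1.1 i), fun i => hτ _ hcons i⟩).2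

/-- A positional strategy whose plays are all accepted by the automaton gives a safe strategy in
the product game. -/
theorem PosStrategy.exists_ensuresSafety {W : Finset ℤ} {G : MPGame W} {A : SafetyAut W}
    (ρ : PosStrategy G)
    (hρ : ∀ π, InfPath ρ.edges π → (π 0).1 = G.init → (fun i => (π i).2.1) ∈ A.Lang) :
    ∃ τ : UStrategy (prodGame G A), EnsuresSafety τ {x : G.V × A.Q | x.2 = A.bot} := by
  let pos : G.V × A.Q → (G.V × A.Q) × (G.V × A.Q) := fun x => liftEdge A x.2 (ρ.f x.1)
  have hpos : ∀ x : G.V × A.Q, x.1 ∈ G.EveV → pos x ∈ (prodGame G A).E ∧ (pos x).1 = x :=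
    fun x hx => ⟨mem_prodGame_edges.2 ⟨ρ.f x.1, (ρ.valid _ hx).1, rfl⟩,
      Prod.ext (ρ.valid _ hx).2 rfl⟩
  refine ⟨⟨fun p => pos (lastVU (prodGame G A).init p), fun p _ hp => hpos _ hp⟩,
    fun χ hχ i => ?_⟩
  have hedge : ∀ i, ∃ e ∈ ρ.edges, liftEdge A (χ i).1.2 e = χ i := by
    intro i
    obtain ⟨e, he, hee⟩ := mem_prodGame_edges.1 (hχ.1.1 i)
    by_cases hi : (χ i).1.1 ∈ G.EveV
    · have h := hχ.2.2 i hi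
      have hl := lastVU_map_range hχ.1 i
      rw [hχ.2.1] at hl
      have hv := ρ.valid _ hi
      exact ⟨ρ.f (χ i).1.1, ⟨hv.1, fun _ => by rw [hv.2]⟩,
        (congrArg pos hl).symm.trans h⟩
    · refine ⟨e, ⟨he, fun h => absurd ?_ hi⟩, hee⟩
      rw [← hee]
      exact h
  choose π hπE hπ using hedge
  have hsrc : ∀ i, (π i).1 = (χ i).1.1 := fun i => congrArg (fun x => x.1.1) (hπ i)
  have hpath : InfPath ρ.edges π := by
    refine ⟨hπE, fun i => ?_⟩
    rw [hsrc (i + 1), ← hχ.1.2 i]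
    exact congrArg (fun x => x.2.1) (hπ i)
  have hrun : ∀ i, A.run (fun i => (π i).2.1) i = (χ i).1.2 := by
    intro i
    induction i with
    | zero => exact (congrArg Prod.snd hχ.2.1).symm
    | succ i ih =>
      rw [← hχ.1.2 i, SafetyAut.run, ih]
      exact congrArg (fun x => x.2.2) (hπ i)
  have hacc := (hρ π hpath ((hsrc 0).trans (congrArg Prod.fst hχ.2.1))).2 i
  rwa [hrun i] at hacc

/-- for an `(n,W)`-mean payoff game `G` and an `(n,W)`-separating
automaton `A`, Eve has a strategy ensuring mean payoff in `G` iff she has a strategy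
ensuring safety in the safety game `G × A`. -/
theorem ensuresMP_iff_ensuresSafety {W : Finset ℤ} (n : ℕ) (G : MPGame W)
    (hG : Fintype.card G.V ≤ n) (A : SafetyAut W) (hA : Separating n A) :
    (∃ σ : Strategy G, EnsuresMP σ) ↔
      ∃ τ : UStrategy (prodGame G A),
        EnsuresSafety τ {x : G.V × A.Q | x.2 = A.bot} := by
  constructor
  · rintro ⟨σ, hσ⟩
    obtain ⟨ρ, hρ⟩ := exists_posStrategy_mem_MPn hG σ hσ
    exact ρ.exists_ensuresSafety fun π hπ h0 => hA.1 (hρ π hπ h0)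
  · rintro ⟨τ, hτ⟩
    exact exists_ensuresMP_of_ensuresSafety hA.2 τ hτ
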